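/- Let 𝔭 ∈ 𝔓_D and i ∈ {0,…,n−1} be such that 𝔭^{-1}(i+1) = ∅. Fix a partition of 𝔭^{-1}(i) into pairwise disjoint subsets J, K_1, …, K_t such that each K_s = {k_s, l_s} with k_s < l_s has exactly two elements, no element of J lies in the interval [k_s, l_s], and for s ≠ s′ the intervals [k_s, l_s] and [k_{s′}, l_{s′}] are either disjoint or one is contained in the other. For 0 ≤ l ≤ #J let 𝔭_l ∈ 𝔓_D be defined by: 𝔭_l(j) = 𝔭(j) for all j not congruent mod D to an element of 𝔭^{-1}(i); 𝔭_l takes the value i+1 at the l smallest elements of J and the value i at the remaining elements of J; 𝔭_l(k_s) = i and 𝔭_l(l_s) = i+1 for each s; these values are extended by 𝔭_l(k+mD) = 𝔭_l(k) + mn. (Then J, K_1, …, K_t is an admissible partition of 𝔭_l^{-1}({i,i+1}), so ⟨𝔭_l⟩ ∈ T_D is defined.) Then for all 0 ≤ l ≤ #J one has F_i(⟨𝔭_l⟩) = [l + 1]·⟨𝔭_{l+1}⟩, with the convention ⟨𝔭_{#J+1}⟩ = 0. -/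

import Mathlib

open LaurentPolynomial

open scoped Classical

noncomputable section

/-- `T_D`: the free module over `ℤ[v,v⁻¹]` with basis indexed by functions `ℤ → ℤ`
(only basis elements `[𝔭]` with `𝔭 ∈ 𝔓_D` are used). -/
abbrev TD := (ℤ → ℤ) →₀ LaurentPolynomial ℤ

/-- The basis element `[𝔭]`. -/
def bas (p : ℤ → ℤ) : TD := Finsupp.single p 1

/-- Membership in `𝔓_D`. -/
def IsPD (n D : ℕ) (p : ℤ → ℤ) : Prop := ∀ j : ℤ, p (j + D) = p j + n

/-- `𝔭_k^ε` : the value is shifted by `ε` on the congruence class of `k` mod `D`. -/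
def pShift (D : ℕ) (p : ℤ → ℤ) (k ε j : ℤ) : ℤ := if (D : ℤ) ∣ (j - k) then p j + ε else p j

/-- The exponent `f(𝔭,k)` in the formula for `F_i`. -/
def fcoef (p : ℤ → ℤ) (i k : ℤ) : ℤ :=
  ({l : ℤ | p l = i ∧ l < k}.ncard : ℤ) - ({l : ℤ | p l = i + 1 ∧ l < k}.ncard : ℤ)

/-- The operator `F_i` on `T_D`. -/
def Fop (D : ℕ) (i : ℤ) (x : TD) : TD :=
  x.sum fun p c =>
    ∑ᶠ k ∈ {k : ℤ | p k = i}, (c * T (fcoef p i k)) • bas (pShift D p k 1)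

/-- `𝔭_{A,B}`, encoded through the set `Up` of elements of `𝔭⁻¹({i,i+1})` where the new
value is `i+1` : the value is raised by 1 on congruence classes of points of `Up` with value `i`,
and lowered by 1 on congruence classes of points with value `i+1` not belonging to `Up`. -/
def pAB (D : ℕ) (p : ℤ → ℤ) (i : ℤ) (Up : Set ℤ) (j : ℤ) : ℤ :=
  p j + (if ∃ k ∈ Up, p k = i ∧ (D : ℤ) ∣ (j - k) then 1 else 0)
      - (if ∃ k, p k = i + 1 ∧ k ∉ Up ∧ (D : ℤ) ∣ (j - k) then 1 else 0)

/-- The set of points of `𝔭⁻¹({i,i+1})` receiving the value `i+1` in `𝔭_{A,B}`: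
all of `A`, the minima of the pairs `K_s` with `s ∈ B`, the maxima of the pairs `K_s`
with `s ∉ B`. -/
def UpSet {t : ℕ} (A : Finset ℤ) (B : Finset (Fin t)) (K : Fin t → ℤ × ℤ) : Set ℤ :=
  ↑A ∪ {x | ∃ s ∈ B, x = (K s).1} ∪ {x | ∃ s, s ∉ B ∧ x = (K s).2}

/-- `n_A = #{(k,l) ∈ A × (J∖A) : k > l}`. -/
def nA (J A : Finset ℤ) : ℕ := ((A ×ˢ (J \ A)).filter fun q => q.2 < q.1).card

/-- `⟨𝔭⟩`, relative to an admissible partition `J, K_1, …, K_t` of `𝔭⁻¹({i,i+1})`. -/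
def bracket (D : ℕ) (p : ℤ → ℤ) (i : ℤ) (J : Finset ℤ) {t : ℕ} (K : Fin t → ℤ × ℤ) : TD :=
  ∑ A ∈ J.powerset.filter (fun A => A.card = (J.filter fun x => p x = i + 1).card),
    ∑ B : Finset (Fin t),
      ((T (nA J A : ℤ) : LaurentPolynomial ℤ) * (-T 1) ^ B.card) • bas (pAB D p i (UpSet A B K))

/-- The `l` smallest elements of a finite set of integers. -/
def smallest (J : Finset ℤ) (l : ℕ) : Finset ℤ := ((J.sort (· ≤ ·)).take l).toFinset

/-- The flag `𝔭_l` : starting from `𝔭` with `𝔭⁻¹(i+1) = ∅` and a partition `J, K_1, …, K_t`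
of `𝔭⁻¹(i)`, raise the value to `i+1` at the `l` smallest elements of `J` and at the maxima
of all the pairs `K_s`. -/
def pl (D : ℕ) (p : ℤ → ℤ) (i : ℤ) (J : Finset ℤ) {t : ℕ} (K : Fin t → ℤ × ℤ) (l : ℕ) :
    ℤ → ℤ :=
  pAB D p i (↑(smallest J l) ∪ {x | ∃ s, x = (K s).2})

/-- The quantum integer `[s] = v^{s-1} + v^{s-3} + ⋯ + v^{1-s}`. -/
def qInt (s : ℕ) : LaurentPolynomial ℤ :=
  ∑ j ∈ Finset.range s, T ((s : ℤ) - 1 - 2 * j)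

lemma Fop_eq (D : ℕ) (i : ℤ) (x : TD) :
    Fop D i x = Finsupp.linearCombination (LaurentPolynomial ℤ)
      (fun p : ℤ → ℤ => ∑ᶠ k ∈ {k : ℤ | p k = i},
        (T (fcoef p i k) : LaurentPolynomial ℤ) • bas (pShift D p k 1)) x := by
  rw [Finsupp.linearCombination_apply]
  unfold Fop
  congr 1
  funext p c
  rw [smul_finsum]
  congr 1
  funext k
  rw [smul_finsum]
  congr 1
  funext h
  rw [smul_smul]

lemma IsPD_mul {n D : ℕ} {p : ℤ → ℤ} (hp : IsPD n D p) (x m : ℤ) :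
    p (x + D * m) = p x + n * m := by
  induction m using Int.induction_on with
  | zero => simp
  | succ m ih =>
    have := hp (x + D * m)
    rw [ih] at this
    rw [show x + D * ((m : ℤ) + 1) = x + D * m + D by ring, this]; ring
  | pred m ih =>
    have := hp (x + D * (-(m : ℤ) - 1))
    rw [show x + D * (-(m : ℤ) - 1) + D = x + D * (-(m : ℤ)) by ring, ih] at this
    linear_combination -this

lemma sep1 {n D : ℕ} (hn : 0 < n) {p : ℤ → ℤ} (hp : IsPD n D p) {i : ℤ} {x y : ℤ}
    (hx : p x = i) (hy : p y = i) (h : (D : ℤ) ∣ y - x) : y = x := by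
  obtain ⟨m, hm⟩ := h
  have h1 := IsPD_mul hp x m
  rw [show x + D * m = y by linarith, hx, hy] at h1
  have h2 : (n : ℤ) * m = 0 := by linarith
  rcases mul_eq_zero.1 h2 with h | h
  · omega
  · subst h; simp at hm; linarith

lemma sep2 {n D : ℕ} {p : ℤ → ℤ} (hp : IsPD n D p) {i : ℤ}
    (hempty : ∀ k : ℤ, p k ≠ i + 1) {x y : ℤ}
    (hx : p x = i) (hy : p y + 1 = i) (h : (D : ℤ) ∣ y - x) : False := by
  obtain ⟨m, hm⟩ := h
  have h1 := IsPD_mul hp x (-m)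
  have h2 := IsPD_mul hp x m
  rw [show x + D * m = y by linarith] at h2
  apply hempty (x + D * (-m))
  rw [h1]; linarith

lemma q_apply (D : ℕ) {p : ℤ → ℤ} {i : ℤ} (hempty : ∀ k : ℤ, p k ≠ i + 1) {U : Set ℤ}
    (hU : ∀ k ∈ U, p k = i) (j : ℤ) :
    pAB D p i U j = p j + if ∃ k ∈ U, (D : ℤ) ∣ j - k then 1 else 0 := by
  unfold pAB
  rw [if_neg (c := ∃ k, p k = i + 1 ∧ k ∉ U ∧ (D : ℤ) ∣ (j - k))
    (by rintro ⟨k, hk, _⟩; exact hempty k hk)]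
  have : (∃ k ∈ U, p k = i ∧ (D : ℤ) ∣ j - k) ↔ (∃ k ∈ U, (D : ℤ) ∣ j - k) :=
    ⟨fun ⟨k, a, b, c⟩ => ⟨k, a, c⟩, fun ⟨k, a, c⟩ => ⟨k, a, hU k a, c⟩⟩
  simp only [this, sub_zero]

section
variable {n D : ℕ} (hn : 0 < n) {p : ℤ → ℤ} (hp : IsPD n D p) {i : ℤ}
  (hempty : ∀ k : ℤ, p k ≠ i + 1) {U : Set ℤ} (hU : ∀ k ∈ U, p k = i)

lemma q_eq_i (hn : 0 < n) (hp : IsPD n D p) (hempty : ∀ k : ℤ, p k ≠ i + 1)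
    (hU : ∀ k ∈ U, p k = i) (x : ℤ) : pAB D p i U x = i ↔ p x = i ∧ x ∉ U := by
  rw [q_apply D hempty hU]
  split_ifs with h
  · obtain ⟨k, hk, hd⟩ := h
    constructor
    · intro h; exact (sep2 hp hempty (hU k hk) h hd).elim
    · rintro ⟨h1, h2⟩
      have := sep1 hn hp (hU k hk) h1 hd
      subst this; exact (h2 hk).elim
  · constructor
    · intro h1
      exact ⟨by linarith, fun hx => h ⟨x, hx, by simp⟩⟩
    · rintro ⟨h1, _⟩; linarith

lemma q_eq_i1 (hn : 0 < n) (hp : IsPD n D p) (hempty : ∀ k : ℤ, p k ≠ i + 1)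
    (hU : ∀ k ∈ U, p k = i) (x : ℤ) : pAB D p i U x = i + 1 ↔ x ∈ U := by
  rw [q_apply D hempty hU]
  split_ifs with h
  · obtain ⟨k, hk, hd⟩ := h
    constructor
    · intro h
      have := sep1 hn hp (hU k hk) (by linarith) hd
      subst this; exact hk
    · intro hx; rw [hU x hx]
  · constructor
    · intro h1
      exact (hempty x (by linarith)).elim
    · intro hx; exact (h ⟨x, hx, by simp⟩).elim

lemma q_shift (hn : 0 < n) (hp : IsPD n D p) (hempty : ∀ k : ℤ, p k ≠ i + 1)
    (hU : ∀ k ∈ U, p k = i) {k : ℤ} (hk : p k = i) (hkU : k ∉ U) :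
    pShift D (pAB D p i U) k 1 = pAB D p i (insert k U) := by
  funext j
  have hU' : ∀ x ∈ insert k U, p x = i := by
    rintro x (rfl | hx)
    · exact hk
    · exact hU x hx
  rw [q_apply D hempty hU']
  unfold pShift
  rw [q_apply D hempty hU]
  by_cases h : (D : ℤ) ∣ j - k
  · rw [if_pos h, if_pos (c := ∃ x ∈ insert k U, (D : ℤ) ∣ j - x) ⟨k, Set.mem_insert _ _, h⟩,
      if_neg]
    · ring
    · rintro ⟨k', hk', hd⟩
      have := sep1 hn hp (hU k' hk') hk (by have := dvd_sub hd h; simpa using this)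
      subst this; exact hkU hk'
  · rw [if_neg h]
    have : (∃ x ∈ insert k U, (D : ℤ) ∣ j - x) ↔ (∃ x ∈ U, (D : ℤ) ∣ j - x) := by
      constructor
      · rintro ⟨x, (rfl | hx), hd⟩
        · exact (h hd).elim
        · exact ⟨x, hx, hd⟩
      · rintro ⟨x, hx, hd⟩; exact ⟨x, Or.inr hx, hd⟩
    simp only [this]

lemma q_pAB (hn : 0 < n) (hp : IsPD n D p) (hempty : ∀ k : ℤ, p k ≠ i + 1)
    (hU : ∀ k ∈ U, p k = i) {V : Set ℤ} (hV : ∀ k ∈ V, p k = i) :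
    pAB D (pAB D p i U) i V = pAB D p i V := by
  funext j
  rw [q_apply D hempty hV]
  have h0 : pAB D (pAB D p i U) i V j = pAB D p i U j
      + (if ∃ k ∈ V, pAB D p i U k = i ∧ (D : ℤ) ∣ (j - k) then 1 else 0)
      - (if ∃ k, pAB D p i U k = i + 1 ∧ k ∉ V ∧ (D : ℤ) ∣ (j - k) then 1 else 0) := rfl
  rw [h0]
  simp only [q_eq_i hn hp hempty hU, q_eq_i1 hn hp hempty hU]
  rw [q_apply D hempty hU]
  by_cases h : ∃ k, p k = i ∧ (D : ℤ) ∣ j - k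
  · obtain ⟨k, hk, hd⟩ := h
    have key : ∀ x, p x = i → (D : ℤ) ∣ j - x → x = k := fun x hx hdx =>
      sep1 hn hp hk hx (by have := dvd_sub hd hdx; simpa using this)
    have e1 : (∃ x ∈ U, (D : ℤ) ∣ j - x) ↔ k ∈ U :=
      ⟨fun ⟨x, hx, h⟩ => key x (hU x hx) h ▸ hx, fun h => ⟨k, h, hd⟩⟩
    have e2 : (∃ x ∈ V, (D : ℤ) ∣ j - x) ↔ k ∈ V :=
      ⟨fun ⟨x, hx, h⟩ => key x (hV x hx) h ▸ hx, fun h => ⟨k, h, hd⟩⟩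
    have e3 : (∃ x ∈ V, (p x = i ∧ x ∉ U) ∧ (D : ℤ) ∣ j - x) ↔ k ∈ V ∧ k ∉ U :=
      ⟨fun ⟨x, hx, ⟨_, h'⟩, h⟩ => key x (hV x hx) h ▸ ⟨hx, h'⟩,
        fun h => ⟨k, h.1, ⟨hk, h.2⟩, hd⟩⟩
    have e4 : (∃ x ∈ U, x ∉ V ∧ (D : ℤ) ∣ j - x) ↔ k ∈ U ∧ k ∉ V :=
      ⟨fun ⟨x, hx, h', h⟩ => key x (hU x hx) h ▸ ⟨hx, h'⟩,
        fun h => ⟨k, h.1, h.2, hd⟩⟩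
    simp only [e1, e2, e3, e4]
    by_cases a : k ∈ U <;> by_cases b : k ∈ V <;> simp [a, b]
  · rw [if_neg, if_neg, if_neg, if_neg]
    · ring
    · rintro ⟨x, hx, hd⟩; exact h ⟨x, hV x hx, hd⟩
    · rintro ⟨x, hx, _, hd⟩; exact h ⟨x, hU x hx, hd⟩
    · rintro ⟨x, hx, _, hd⟩; exact h ⟨x, hV x hx, hd⟩
    · rintro ⟨x, hx, hd⟩; exact h ⟨x, hU x hx, hd⟩
end

/-- Local weight. -/
def wt (U : Set ℤ) (k x : ℤ) : ℤ := if x < k then (if x ∈ U then -1 else 1) else 0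

lemma ncard_eq (P : Finset ℤ) (Q : ℤ → Prop) (h : ∀ x, Q x → x ∈ P) :
    ({x | Q x}.ncard : ℤ) = ∑ x ∈ P, if Q x then 1 else 0 := by
  rw [Finset.sum_boole]
  congr 1
  rw [← Set.ncard_coe_finset]
  congr 1
  ext x
  simp only [Set.mem_ofPred_eq, Finset.coe_filter]
  exact ⟨fun hx => ⟨h x hx, hx⟩, fun hx => hx.2⟩

/-- Part of the combinatorics: sum over `P` split. -/
lemma sum_P {M : Type*} [AddCommMonoid M] {p : ℤ → ℤ} {i : ℤ}
    {J : Finset ℤ} {t : ℕ} {K : Fin t → ℤ × ℤ}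
    (hKlt : ∀ s, (K s).1 < (K s).2)
    (hcover : ∀ x : ℤ, p x = i ↔ (x ∈ J ∨ ∃ s, x = (K s).1 ∨ x = (K s).2))
    (hJK : ∀ s, (K s).1 ∉ J ∧ (K s).2 ∉ J)
    (hKK : ∀ s s', s ≠ s' →
      (K s).1 ≠ (K s').1 ∧ (K s).1 ≠ (K s').2 ∧ (K s).2 ≠ (K s').1 ∧ (K s).2 ≠ (K s').2) :
    ∃ P : Finset ℤ, (∀ x, x ∈ P ↔ p x = i) ∧
      ∀ g : ℤ → M, ∑ x ∈ P, g x = ∑ x ∈ J, g x + ∑ s, (g (K s).1 + g (K s).2) := by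
  refine ⟨J ∪ (Finset.univ.image (fun s => (K s).1) ∪ Finset.univ.image (fun s => (K s).2)),
    ?_, ?_⟩
  · intro x
    rw [hcover]
    simp only [Finset.mem_union, Finset.mem_image, Finset.mem_univ, true_and]
    constructor
    · rintro (h | ⟨s, rfl⟩ | ⟨s, rfl⟩)
      · exact Or.inl h
      · exact Or.inr ⟨s, Or.inl rfl⟩
      · exact Or.inr ⟨s, Or.inr rfl⟩
    · rintro (h | ⟨s, rfl | rfl⟩)
      · exact Or.inl h
      · exact Or.inr (Or.inl ⟨s, rfl⟩)
      · exact Or.inr (Or.inr ⟨s, rfl⟩)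
  · intro g
    rw [Finset.sum_union, Finset.sum_union, Finset.sum_image, Finset.sum_image,
      Finset.sum_add_distrib]
    · intro s _ s' _ h
      by_contra hne
      exact (hKK s s' hne).2.2.2 h
    · intro s _ s' _ h
      by_contra hne
      exact (hKK s s' hne).1 h
    · rw [Finset.disjoint_left]
      intro x hx hx'
      simp only [Finset.mem_image, Finset.mem_univ, true_and] at hx hx'
      obtain ⟨s, rfl⟩ := hx
      obtain ⟨s', h⟩ := hx'
      by_cases hss : s = s'
      · subst hss; have := hKlt s; omega
      · exact (hKK s s' hss).2.1 h.symm
    · rw [Finset.disjoint_left]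
      intro x hx hx'
      simp only [Finset.mem_union, Finset.mem_image, Finset.mem_univ, true_and] at hx'
      rcases hx' with ⟨s, rfl⟩ | ⟨s, rfl⟩
      · exact (hJK s).1 hx
      · exact (hJK s).2 hx

lemma qsum (A : Finset ℤ) : ∑ k ∈ A, (T (((A.filter (fun x => k < x)).card : ℤ) -
    ((A.filter (fun x => x < k)).card : ℤ)) : LaurentPolynomial ℤ) = qInt A.card := by
  induction A using Finset.induction_on_max with
  | empty => simp [qInt]
  | insert a s ha ih =>
    have has : a ∉ s := fun h => lt_irrefl _ (ha a h)
    rw [Finset.sum_insert has, Finset.card_insert_of_notMem has]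
    have e1 : (insert a s).filter (fun x => a < x) = ∅ := by
      ext x; simp only [Finset.mem_filter, Finset.mem_insert, Finset.notMem_empty, iff_false]
      rintro ⟨rfl | hx, h⟩
      · exact lt_irrefl _ h
      · exact lt_asymm h (ha x hx)
    have e2 : (insert a s).filter (fun x => x < a) = s := by
      ext x; simp only [Finset.mem_filter, Finset.mem_insert]
      constructor
      · rintro ⟨rfl | hx, h⟩
        · exact (lt_irrefl _ h).elim
        · exact hx
      · intro hx; exact ⟨Or.inr hx, ha x hx⟩
    rw [e1, e2]
    have e3 : ∀ k ∈ s, (T ((((insert a s).filter (fun x => k < x)).card : ℤ) -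
        (((insert a s).filter (fun x => x < k)).card : ℤ)) : LaurentPolynomial ℤ) =
        T 1 * T (((s.filter (fun x => k < x)).card : ℤ) -
          ((s.filter (fun x => x < k)).card : ℤ)) := by
      intro k hk
      rw [← T_add, Finset.filter_insert, if_pos (ha k hk), Finset.filter_insert,
        if_neg (not_lt.2 (ha k hk).le), Finset.card_insert_of_notMem (by simp [has])]
      congr 1; push_cast; ring
    rw [Finset.sum_congr rfl e3, ← Finset.mul_sum, ih]
    unfold qInt
    rw [Finset.sum_range_succ, Finset.mul_sum, add_comm]
    congr 1
    · apply Finset.sum_congr rfl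
      intro j _
      rw [← T_add]; congr 1; push_cast; ring
    · congr 1; push_cast; simp; ring

lemma nA_insert (J A : Finset ℤ) (hA : A ⊆ J) (k : ℤ) (hk : k ∈ A) :
    (nA J (A.erase k) : ℤ) + (((J \ A).filter (fun x => x < k)).card : ℤ) =
      nA J A + ((A.filter (fun x => k < x)).card : ℤ) := by
  have key : ∀ (A B : Finset ℤ), ((A ×ˢ B).filter fun q => q.2 < q.1).card =
      ∑ a ∈ A, (B.filter (fun x => x < a)).card := by
    intro A B
    simp only [Finset.card_filter]
    rw [Finset.sum_product]
  have hkJ : k ∉ J \ A := by simp [hk]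
  have e : J \ A.erase k = insert k (J \ A) := by
    ext x; simp only [Finset.mem_sdiff, Finset.mem_erase, Finset.mem_insert]
    constructor
    · rintro ⟨h1, h2⟩
      by_cases h : x = k
      · exact Or.inl h
      · exact Or.inr ⟨h1, fun h' => h2 ⟨h, h'⟩⟩
    · rintro (rfl | ⟨h1, h2⟩)
      · exact ⟨hA hk, fun h => h.1 rfl⟩
      · exact ⟨h1, fun h => h2 h.2⟩
  unfold nA
  rw [key, key, e, ← Finset.add_sum_erase A _ hk]
  have e2 : ∀ a ∈ A.erase k, ((insert k (J \ A)).filter (fun x => x < a)).card =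
      ((J \ A).filter (fun x => x < a)).card + if k < a then 1 else 0 := by
    intro a _
    rw [Finset.filter_insert]
    split_ifs
    · rw [Finset.card_insert_of_notMem (fun h => hkJ (Finset.mem_filter.1 h).1)]
    · rfl
  rw [Finset.sum_congr rfl e2, Finset.sum_add_distrib, ← Finset.card_filter]
  have e3 : (A.erase k).filter (fun x => k < x) = A.filter (fun x => k < x) := by
    ext x; simp only [Finset.mem_filter, Finset.mem_erase]
    constructor
    · rintro ⟨⟨_, h⟩, h'⟩; exact ⟨h, h'⟩
    · rintro ⟨h, h'⟩; exact ⟨⟨h'.ne', h⟩, h'⟩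
  rw [e3]; push_cast; ring

section
variable {J : Finset ℤ} {t : ℕ} {K : Fin t → ℤ × ℤ} {A : Finset ℤ} (B : Finset (Fin t))

lemma Up_J (hJK : ∀ s, (K s).1 ∉ J ∧ (K s).2 ∉ J) {x : ℤ} (hx : x ∈ J) :
    x ∈ UpSet A B K ↔ x ∈ A := by
  unfold UpSet
  constructor
  · rintro ((h | ⟨s, _, rfl⟩) | ⟨s, _, rfl⟩)
    · exact h
    · exact ((hJK s).1 hx).elim
    · exact ((hJK s).2 hx).elim
  · intro h; exact Or.inl (Or.inl h)

lemma Up_1 (hA : A ⊆ J) (hKlt : ∀ s, (K s).1 < (K s).2)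
    (hJK : ∀ s, (K s).1 ∉ J ∧ (K s).2 ∉ J)
    (hKK : ∀ s s', s ≠ s' →
      (K s).1 ≠ (K s').1 ∧ (K s).1 ≠ (K s').2 ∧ (K s).2 ≠ (K s').1 ∧ (K s).2 ≠ (K s').2)
    (s : Fin t) : (K s).1 ∈ UpSet A B K ↔ s ∈ B := by
  unfold UpSet
  constructor
  · rintro ((h | ⟨s', hs, h⟩) | ⟨s', hs, h⟩)
    · exact ((hJK s).1 (hA h)).elim
    · by_cases e : s = s'
      · exact e ▸ hs
      · exact ((hKK s s' e).1 h).elim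
    · by_cases e : s = s'
      · subst e; exact absurd h (hKlt s).ne
      · exact ((hKK s s' e).2.1 h).elim
  · intro h; exact Or.inl (Or.inr ⟨s, h, rfl⟩)

lemma Up_2 (hA : A ⊆ J) (hKlt : ∀ s, (K s).1 < (K s).2)
    (hJK : ∀ s, (K s).1 ∉ J ∧ (K s).2 ∉ J)
    (hKK : ∀ s s', s ≠ s' →
      (K s).1 ≠ (K s').1 ∧ (K s).1 ≠ (K s').2 ∧ (K s).2 ≠ (K s').1 ∧ (K s).2 ≠ (K s').2)
    (s : Fin t) : (K s).2 ∈ UpSet A B K ↔ s ∉ B := by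
  unfold UpSet
  constructor
  · rintro ((h | ⟨s', hs, h⟩) | ⟨s', hs, h⟩)
    · exact ((hJK s).2 (hA h)).elim
    · by_cases e : s = s'
      · subst e; exact absurd h (hKlt s).ne'
      · exact ((hKK s s' e).2.2.1 h).elim
    · by_cases e : s = s'
      · exact e ▸ hs
      · exact ((hKK s s' e).2.2.2 h).elim
  · intro h; exact Or.inr ⟨s, h, rfl⟩
end

/-- The exponent in terms of the partition. -/
def ex (J : Finset ℤ) {t : ℕ} (K : Fin t → ℤ × ℤ) (U : Set ℤ) (k : ℤ) : ℤ :=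
  ∑ x ∈ J, wt U k x + ∑ s, (wt U k (K s).1 + wt U k (K s).2)

section
variable {J : Finset ℤ} {t : ℕ} {K : Fin t → ℤ × ℤ} {A : Finset ℤ} (B : Finset (Fin t))

/-- exponent at a point of `J`. -/
lemma ex_J (hA : A ⊆ J) (hKlt : ∀ s, (K s).1 < (K s).2)
    (hJK : ∀ s, (K s).1 ∉ J ∧ (K s).2 ∉ J)
    (hKK : ∀ s s', s ≠ s' →
      (K s).1 ≠ (K s').1 ∧ (K s).1 ≠ (K s').2 ∧ (K s).2 ≠ (K s').1 ∧ (K s).2 ≠ (K s').2)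
    (hnoJ : ∀ s, ∀ j ∈ J, ¬((K s).1 ≤ j ∧ j ≤ (K s).2)) {k : ℤ} (hk : k ∈ J) :
    ex J K (UpSet A B K) k =
      (((J \ A).filter (fun x => x < k)).card : ℤ) - ((A.filter (fun x => x < k)).card : ℤ) := by
  unfold ex
  have h2 : ∀ s, wt (UpSet A B K) k (K s).1 + wt (UpSet A B K) k (K s).2 = 0 := by
    intro s
    unfold wt
    rw [Up_1 B hA hKlt hJK hKK, Up_2 B hA hKlt hJK hKK]
    have h1 := hnoJ s k hk
    have h3 := hKlt s
    by_cases a : (K s).1 < k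
    · have b : (K s).2 < k := by
        by_contra hb
        exact h1 ⟨a.le, not_lt.1 hb⟩
      by_cases c : s ∈ B <;> simp [a, b, c]
    · have b : ¬ (K s).2 < k := by omega
      simp [a, b]
  rw [Finset.sum_eq_zero (fun s _ => h2 s), add_zero, ← Finset.sum_sdiff hA,
    Finset.card_filter, Finset.card_filter]
  push_cast
  rw [sub_eq_add_neg, ← Finset.sum_neg_distrib]
  congr 1
  · apply Finset.sum_congr rfl
    intro x hx
    rw [Finset.mem_sdiff] at hx
    unfold wt
    rw [Up_J B hJK hx.1, if_neg hx.2]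
  · apply Finset.sum_congr rfl
    intro x hx
    unfold wt
    rw [Up_J B hJK (hA hx), if_pos hx]
    split_ifs <;> rfl

lemma ex_K (hA : A ⊆ J) (hKlt : ∀ s, (K s).1 < (K s).2)
    (hJK : ∀ s, (K s).1 ∉ J ∧ (K s).2 ∉ J)
    (hKK : ∀ s s', s ≠ s' →
      (K s).1 ≠ (K s').1 ∧ (K s).1 ≠ (K s').2 ∧ (K s).2 ≠ (K s').1 ∧ (K s).2 ≠ (K s').2)
    (hnoJ : ∀ s, ∀ j ∈ J, ¬((K s).1 ≤ j ∧ j ≤ (K s).2))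
    (hnest : ∀ s s', s ≠ s' →
      Disjoint (Set.Icc (K s).1 (K s).2) (Set.Icc (K s').1 (K s').2) ∨
      Set.Icc (K s).1 (K s).2 ⊆ Set.Icc (K s').1 (K s').2 ∨
      Set.Icc (K s').1 (K s').2 ⊆ Set.Icc (K s).1 (K s).2)
    {s : Fin t} (hs : s ∉ B) :
    ex J K (UpSet A B K) (K s).1 = ex J K (UpSet A (insert s B) K) (K s).2 + 1 := by
  unfold ex
  rw [add_assoc]
  congr 1
  · apply Finset.sum_congr rfl
    intro x hx
    unfold wt
    rw [Up_J B hJK hx, Up_J _ hJK hx]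
    have h1 := hnoJ s x hx
    have h3 := hKlt s
    have : x < (K s).1 ↔ x < (K s).2 := by
      constructor
      · intro h; omega
      · intro h; by_contra h'; exact h1 ⟨not_lt.1 h', h.le⟩
    simp only [this]
  · rw [← Finset.add_sum_erase _ _ (Finset.mem_univ s),
      ← Finset.add_sum_erase (a := s) Finset.univ
        (fun s' => wt (UpSet A (insert s B) K) (K s).2 (K s').1 +
          wt (UpSet A (insert s B) K) (K s).2 (K s').2) (Finset.mem_univ s)]
    have e : ∀ s' ∈ Finset.univ.erase s,
        wt (UpSet A B K) (K s).1 (K s').1 + wt (UpSet A B K) (K s).1 (K s').2 =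
        wt (UpSet A (insert s B) K) (K s).2 (K s').1 +
          wt (UpSet A (insert s B) K) (K s).2 (K s').2 := by
      intro s' hs'
      have hne : s' ≠ s := Finset.ne_of_mem_erase hs'
      unfold wt
      rw [Up_1 B hA hKlt hJK hKK, Up_2 B hA hKlt hJK hKK, Up_1 _ hA hKlt hJK hKK,
        Up_2 _ hA hKlt hJK hKK]
      have hm : s' ∈ insert s B ↔ s' ∈ B := by simp [hne]
      rw [hm]
      have l1 := hKlt s
      have l2 := hKlt s'
      obtain ⟨k1, k2, k3, k4⟩ := hKK s s' hne.symm
      have hn : ((K s).2 < (K s').1 ∨ (K s').2 < (K s).1) ∨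
          ((K s').1 < (K s).1 ∧ (K s).2 < (K s').2) ∨
          ((K s).1 < (K s').1 ∧ (K s').2 < (K s).2) := by
        rcases hnest s s' hne.symm with h | h | h
        · left
          rw [Set.disjoint_left] at h
          by_contra hc
          push Not at hc
          rcases le_total (K s).1 (K s').1 with h' | h'
          · exact h (a := (K s').1) ⟨h', hc.1⟩ ⟨le_rfl, l2.le⟩
          · exact h (a := (K s).1) ⟨le_rfl, l1.le⟩ ⟨h', hc.2⟩
        · have := (Set.Icc_subset_Icc_iff l1.le).1 h
          right; left; omega
        · have := (Set.Icc_subset_Icc_iff l2.le).1 h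
          right; right; omega
      by_cases c : s' ∈ B <;> simp only [c, if_true, if_false, not_true, not_false_eq_true] <;>
        split_ifs <;> omega
    rw [Finset.sum_congr rfl e]
    have e0 : wt (UpSet A B K) (K s).1 (K s).1 + wt (UpSet A B K) (K s).1 (K s).2 = 0 := by
      have := hKlt s
      unfold wt; simp [this.le]
    have e1 : wt (UpSet A (insert s B) K) (K s).2 (K s).1 +
        wt (UpSet A (insert s B) K) (K s).2 (K s).2 = -1 := by
      unfold wt
      rw [Up_1 _ hA hKlt hJK hKK]
      simp [hKlt s]
    rw [e0, e1]; ring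

lemma Up_ins_J (x : ℤ) : insert x (UpSet A B K) = UpSet (insert x A) B K := by
  ext y
  unfold UpSet
  simp only [Set.mem_insert_iff, Set.mem_union, Finset.mem_coe, Finset.mem_insert, or_assoc]

lemma Up_ins_K {s : Fin t} (hs : s ∉ B) :
    insert (K s).1 (UpSet A B K) = insert (K s).2 (UpSet A (insert s B) K) := by
  ext y
  unfold UpSet
  simp only [Set.mem_insert_iff, Set.mem_union, Finset.mem_coe, Finset.mem_insert,
    Set.mem_ofPred_eq]
  constructor
  · rintro (rfl | (h | ⟨s', h, rfl⟩) | ⟨s', h, rfl⟩)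
    · exact Or.inr (Or.inl (Or.inr ⟨s, Or.inl rfl, rfl⟩))
    · exact Or.inr (Or.inl (Or.inl h))
    · exact Or.inr (Or.inl (Or.inr ⟨s', Or.inr h, rfl⟩))
    · by_cases e : s' = s
      · subst e; exact Or.inl rfl
      · exact Or.inr (Or.inr ⟨s', by simp [e, h], rfl⟩)
  · rintro (rfl | (h | ⟨s', (rfl | h), rfl⟩) | ⟨s', h, rfl⟩)
    · exact Or.inr (Or.inr ⟨s, hs, rfl⟩)
    · exact Or.inr (Or.inl (Or.inl h))
    · exact Or.inl rfl
    · exact Or.inr (Or.inl (Or.inr ⟨s', h, rfl⟩))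
    · exact Or.inr (Or.inr ⟨s', fun h' => h (Or.inr h'), rfl⟩)
end

/-- One term of `F_i`. -/
def term (J : Finset ℤ) {t : ℕ} (K : Fin t → ℤ × ℤ) (Q : Set ℤ → TD) (U : Set ℤ) (k : ℤ) : TD :=
  if k ∈ U then 0 else (T (ex J K U k) : LaurentPolynomial ℤ) • Q (insert k U)

lemma cancelK {J : Finset ℤ} {t : ℕ} {K : Fin t → ℤ × ℤ} {A : Finset ℤ} (Q : Set ℤ → TD)
    (hA : A ⊆ J) (hKlt : ∀ s, (K s).1 < (K s).2)
    (hJK : ∀ s, (K s).1 ∉ J ∧ (K s).2 ∉ J)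
    (hKK : ∀ s s', s ≠ s' →
      (K s).1 ≠ (K s').1 ∧ (K s).1 ≠ (K s').2 ∧ (K s).2 ≠ (K s').1 ∧ (K s).2 ≠ (K s').2)
    (hnoJ : ∀ s, ∀ j ∈ J, ¬((K s).1 ≤ j ∧ j ≤ (K s).2))
    (hnest : ∀ s s', s ≠ s' →
      Disjoint (Set.Icc (K s).1 (K s).2) (Set.Icc (K s').1 (K s').2) ∨
      Set.Icc (K s).1 (K s).2 ⊆ Set.Icc (K s').1 (K s').2 ∨
      Set.Icc (K s').1 (K s').2 ⊆ Set.Icc (K s).1 (K s).2) (s : Fin t) :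
    ∑ B : Finset (Fin t), ((-T 1 : LaurentPolynomial ℤ) ^ B.card) •
      (term J K Q (UpSet A B K) (K s).1 + term J K Q (UpSet A B K) (K s).2) = 0 := by
  have main : ∀ B : Finset (Fin t), s ∉ B →
      ((-T 1 : LaurentPolynomial ℤ) ^ B.card) •
      (term J K Q (UpSet A B K) (K s).1 + term J K Q (UpSet A B K) (K s).2) +
      ((-T 1 : LaurentPolynomial ℤ) ^ (insert s B).card) •
      (term J K Q (UpSet A (insert s B) K) (K s).1 +
        term J K Q (UpSet A (insert s B) K) (K s).2) = 0 := by
    intro B hs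
    unfold term
    simp only [Up_1 _ hA hKlt hJK hKK, Up_2 _ hA hKlt hJK hKK]
    rw [if_neg hs, if_pos hs, if_pos (Finset.mem_insert_self _ _),
      if_neg (not_not.2 (Finset.mem_insert_self _ _)), add_zero, zero_add,
      ex_K B hA hKlt hJK hKK hnoJ hnest hs, Up_ins_K B hs, smul_smul, smul_smul, ← add_smul,
      Finset.card_insert_of_notMem hs, T_add, pow_succ]
    have z : ((-T 1 : LaurentPolynomial ℤ) ^ B.card) *
        (T (ex J K (UpSet A (insert s B) K) (K s).2) * T 1) +
        (-T 1) ^ B.card * -T 1 * T (ex J K (UpSet A (insert s B) K) (K s).2) = 0 := by ring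
    rw [z, zero_smul]
  refine Finset.sum_involution (fun B _ => if s ∈ B then B.erase s else insert s B) ?_ ?_ ?_ ?_
  · intro B _
    by_cases h : s ∈ B
    · simp only [h, if_true]
      have := main (B.erase s) (by simp)
      rw [Finset.insert_erase h] at this
      rw [add_comm]; exact this
    · simp only [h, if_false]
      exact main B h
  · intro B _ _ he
    by_cases h : s ∈ B
    · simp only [h, if_true] at he
      rw [← he] at h; simp at h
    · simp only [h, if_false] at he
      exact h (he ▸ Finset.mem_insert_self _ _)
  · intro B _; exact Finset.mem_univ _
  · intro B _
    by_cases h : s ∈ B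
    · simp [h]
    · simp [h]

lemma sumJ {J : Finset ℤ} {t : ℕ} {K : Fin t → ℤ × ℤ} (Q : Set ℤ → TD) (B : Finset (Fin t))
    (hKlt : ∀ s, (K s).1 < (K s).2)
    (hJK : ∀ s, (K s).1 ∉ J ∧ (K s).2 ∉ J)
    (hKK : ∀ s s', s ≠ s' →
      (K s).1 ≠ (K s').1 ∧ (K s).1 ≠ (K s').2 ∧ (K s).2 ≠ (K s').1 ∧ (K s).2 ≠ (K s').2)
    (hnoJ : ∀ s, ∀ j ∈ J, ¬((K s).1 ≤ j ∧ j ≤ (K s).2)) (l : ℕ) :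
    ∑ A ∈ J.powersetCard l, (T (nA J A : ℤ) : LaurentPolynomial ℤ) •
      ∑ x ∈ J, term J K Q (UpSet A B K) x =
    qInt (l + 1) • ∑ A ∈ J.powersetCard (l + 1), (T (nA J A : ℤ) : LaurentPolynomial ℤ) •
      Q (UpSet A B K) := by
  have L : ∀ A ∈ J.powersetCard l, (T (nA J A : ℤ) : LaurentPolynomial ℤ) •
      ∑ x ∈ J, term J K Q (UpSet A B K) x = ∑ x ∈ J \ A,
      (T (nA J A : ℤ) * T (ex J K (UpSet A B K) x) : LaurentPolynomial ℤ) •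
        Q (UpSet (insert x A) B K) := by
    intro A hA
    have hA := (Finset.mem_powersetCard.1 hA).1
    rw [← Finset.sum_sdiff hA, Finset.sum_eq_zero (s := A), add_zero, Finset.smul_sum]
    · apply Finset.sum_congr rfl
      intro x hx
      rw [Finset.mem_sdiff] at hx
      unfold term
      rw [if_neg (by rw [Up_J B hJK hx.1]; exact hx.2), Up_ins_J, smul_smul]
    · intro x hx
      unfold term
      rw [if_pos]
      rw [Up_J B hJK (hA hx)]; exact hx
  have R : ∀ A ∈ J.powersetCard (l + 1), qInt (l + 1) • (T (nA J A : ℤ) : LaurentPolynomial ℤ) •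
      Q (UpSet A B K) = ∑ x ∈ A,
      (T (nA J (A.erase x) : ℤ) * T (ex J K (UpSet (A.erase x) B K) x) : LaurentPolynomial ℤ) •
        Q (UpSet A B K) := by
    intro A hA
    obtain ⟨hA, hc⟩ := Finset.mem_powersetCard.1 hA
    rw [← Finset.sum_smul, smul_smul, ← hc, ← qsum, Finset.sum_mul]
    congr 1
    apply Finset.sum_congr rfl
    intro x hx
    rw [ex_J B ((Finset.erase_subset _ _).trans hA) hKlt hJK hKK hnoJ (hA hx), ← T_add, ← T_add]
    congr 1
    have := nA_insert J A hA x hx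
    have f1 : (J \ A.erase x).filter (fun y => y < x) = (J \ A).filter (fun y => y < x) := by
      ext y; simp only [Finset.mem_filter, Finset.mem_sdiff, Finset.mem_erase]
      constructor
      · rintro ⟨⟨h1, h2⟩, h3⟩; exact ⟨⟨h1, fun h => h2 ⟨h3.ne, h⟩⟩, h3⟩
      · rintro ⟨⟨h1, h2⟩, h3⟩; exact ⟨⟨h1, fun h => h2 h.2⟩, h3⟩
    have f2 : (A.erase x).filter (fun y => y < x) = A.filter (fun y => y < x) := by
      ext y; simp only [Finset.mem_filter, Finset.mem_erase]
      constructor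
      · rintro ⟨⟨h1, h2⟩, h3⟩; exact ⟨h2, h3⟩
      · rintro ⟨h2, h3⟩; exact ⟨⟨h3.ne, h2⟩, h3⟩
    rw [f1, f2]
    linarith
  rw [Finset.sum_congr rfl L, Finset.smul_sum, Finset.sum_congr rfl R,
    Finset.sum_sigma', Finset.sum_sigma']
  refine Finset.sum_bij' (fun z _ => ⟨insert z.2 z.1, z.2⟩) (fun z _ => ⟨z.1.erase z.2, z.2⟩)
    ?_ ?_ ?_ ?_ ?_
  · rintro ⟨A, x⟩ h
    simp only [Finset.mem_sigma, Finset.mem_powersetCard, Finset.mem_sdiff] at h ⊢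
    obtain ⟨⟨h1, h2⟩, h3, h4⟩ := h
    exact ⟨⟨Finset.insert_subset h3 h1, by rw [Finset.card_insert_of_notMem h4, h2]⟩,
      Finset.mem_insert_self _ _⟩
  · rintro ⟨A, x⟩ h
    simp only [Finset.mem_sigma, Finset.mem_powersetCard, Finset.mem_sdiff] at h ⊢
    obtain ⟨⟨h1, h2⟩, h3⟩ := h
    exact ⟨⟨(Finset.erase_subset _ _).trans h1, by rw [Finset.card_erase_of_mem h3, h2]; rfl⟩,
      h1 h3, by simp⟩
  · rintro ⟨A, x⟩ h
    simp only [Finset.mem_sigma, Finset.mem_powersetCard, Finset.mem_sdiff] at h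
    simp [Finset.erase_insert h.2.2]
  · rintro ⟨A, x⟩ h
    simp only [Finset.mem_sigma, Finset.mem_powersetCard] at h
    simp [Finset.insert_erase h.2]
  · rintro ⟨A, x⟩ h
    simp only [Finset.mem_sigma, Finset.mem_powersetCard, Finset.mem_sdiff] at h
    dsimp only
    rw [Finset.erase_insert h.2.2]

lemma smallest_sub (J : Finset ℤ) (l : ℕ) : smallest J l ⊆ J := by
  intro x hx
  unfold smallest at hx
  rw [List.mem_toFinset] at hx
  exact (Finset.mem_sort _).1 (List.mem_of_mem_take hx)

lemma smallest_card (J : Finset ℤ) (l : ℕ) (hl : l ≤ J.card) : (smallest J l).card = l := by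
  unfold smallest
  rw [List.toFinset_card_of_nodup ((Finset.sort_nodup _ _).sublist (List.take_sublist _ _))]
  simp [hl]

theorem statement1 (n D : ℕ) (hn : 0 < n) (hD : 0 < D)
    (p : ℤ → ℤ) (hp : IsPD n D p) (i : ℤ) (hi0 : 0 ≤ i) (hin : i ≤ (n : ℤ) - 1)
    (hempty : ∀ k : ℤ, p k ≠ i + 1)
    (J : Finset ℤ) (t : ℕ) (K : Fin t → ℤ × ℤ)
    -- each `K_s = {k_s, l_s}` with `k_s < l_s` has exactly two elements
    (hKlt : ∀ s, (K s).1 < (K s).2)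
    -- `J, K_1, …, K_t` cover `𝔭⁻¹(i)` …
    (hcover : ∀ x : ℤ, p x = i ↔ (x ∈ J ∨ ∃ s, x = (K s).1 ∨ x = (K s).2))
    -- … and are pairwise disjoint
    (hJK : ∀ s, (K s).1 ∉ J ∧ (K s).2 ∉ J)
    (hKK : ∀ s s', s ≠ s' →
      (K s).1 ≠ (K s').1 ∧ (K s).1 ≠ (K s').2 ∧ (K s).2 ≠ (K s').1 ∧ (K s).2 ≠ (K s').2)
    -- no element of `J` lies in the interval `[k_s, l_s]`
    (hnoJ : ∀ s, ∀ j ∈ J, ¬((K s).1 ≤ j ∧ j ≤ (K s).2))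
    -- for `s ≠ s'` the intervals are disjoint or nested
    (hnest : ∀ s s', s ≠ s' →
      Disjoint (Set.Icc (K s).1 (K s).2) (Set.Icc (K s').1 (K s').2) ∨
      Set.Icc (K s).1 (K s).2 ⊆ Set.Icc (K s').1 (K s').2 ∨
      Set.Icc (K s').1 (K s').2 ⊆ Set.Icc (K s).1 (K s).2)
    (l : ℕ) (hl : l ≤ J.card) :
    Fop D i (bracket D (pl D p i J K l) i J K) =
      qInt (l + 1) •
        (if l = J.card then 0 else bracket D (pl D p i J K (l + 1)) i J K) := by
  have memi : ∀ {A : Finset ℤ}, A ⊆ J → ∀ B : Finset (Fin t), ∀ k ∈ UpSet A B K, p k = i := by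
    intro A hA B k hk
    rw [hcover]
    rcases hk with (h | ⟨s, _, rfl⟩) | ⟨s, _, rfl⟩
    · exact Or.inl (hA h)
    · exact Or.inr ⟨s, Or.inl rfl⟩
    · exact Or.inr ⟨s, Or.inr rfl⟩
  set Q : Set ℤ → TD := fun U => bas (pAB D p i U) with hQ
  have br : ∀ m, m ≤ J.card → bracket D (pl D p i J K m) i J K =
      ∑ B : Finset (Fin t), ((-T 1 : LaurentPolynomial ℤ) ^ B.card) •
        ∑ A ∈ J.powersetCard m, (T (nA J A : ℤ) : LaurentPolynomial ℤ) • Q (UpSet A B K) := by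
    intro m hm
    have hU : ∀ k ∈ (↑(smallest J m) ∪ {x | ∃ s, x = (K s).2} : Set ℤ), p k = i := by
      rintro k (h | ⟨s, rfl⟩)
      · exact (hcover k).2 (Or.inl (smallest_sub J m h))
      · exact (hcover _).2 (Or.inr ⟨s, Or.inr rfl⟩)
    have hc : (J.filter fun x => pl D p i J K m x = i + 1) = smallest J m := by
      ext x
      unfold pl
      rw [Finset.mem_filter, q_eq_i1 hn hp hempty hU]
      constructor
      · rintro ⟨hx, h | ⟨s, rfl⟩⟩
        · exact h
        · exact ((hJK s).2 hx).elim
      · intro h; exact ⟨smallest_sub J m h, Or.inl h⟩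
    unfold bracket
    rw [hc, smallest_card J m hm, ← Finset.powersetCard_eq_filter, Finset.sum_comm]
    apply Finset.sum_congr rfl
    intro B _
    rw [Finset.smul_sum]
    apply Finset.sum_congr rfl
    intro A hA
    have hA := (Finset.mem_powersetCard.1 hA).1
    unfold pl
    rw [q_pAB hn hp hempty hU (memi hA B), smul_smul, mul_comm]
  obtain ⟨P, hP, hPZ⟩ := sum_P (M := ℤ) hKlt hcover hJK hKK
  obtain ⟨P', hP', hPT⟩ := sum_P (M := TD) hKlt hcover hJK hKK
  have FQ : ∀ {A : Finset ℤ}, A ⊆ J → ∀ B : Finset (Fin t),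
      Fop D i (Q (UpSet A B K)) = ∑ x ∈ J, term J K Q (UpSet A B K) x +
        ∑ s, (term J K Q (UpSet A B K) (K s).1 + term J K Q (UpSet A B K) (K s).2) := by
    intro A hA B
    have hU := memi hA B
    set U := UpSet A B K with hUdef
    rw [Fop_eq, hQ]
    simp only [bas]
    rw [Finsupp.linearCombination_single, one_smul, ← hPT]
    have hfc : ∀ k, fcoef (pAB D p i U) i k = ex J K U k := by
      intro k
      unfold fcoef ex
      rw [← hPZ]
      simp only [q_eq_i hn hp hempty hU, q_eq_i1 hn hp hempty hU]
      rw [ncard_eq P (fun l => (p l = i ∧ l ∉ U) ∧ l < k) (fun x hx => (hP x).2 hx.1.1),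
        ncard_eq P (fun l => l ∈ U ∧ l < k) (fun x hx => (hP x).2 (hU x hx.1)),
        ← Finset.sum_sub_distrib]
      apply Finset.sum_congr rfl
      intro x hx
      have hx := (hP x).1 hx
      unfold wt
      by_cases a : x < k <;> by_cases b : x ∈ U <;> simp [a, b, hx]
    have hset : {k : ℤ | pAB D p i U k = i} = ↑(P'.filter (fun x => x ∉ U)) := by
      ext k
      simp only [Set.mem_ofPred_eq, Finset.coe_filter, hP', q_eq_i hn hp hempty hU]
    rw [hset, finsum_mem_coe_finset, Finset.sum_filter]
    apply Finset.sum_congr rfl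
    intro x hx
    unfold term
    by_cases a : x ∈ U
    · simp [a]
    · rw [if_pos a, if_neg a, hfc, q_shift hn hp hempty hU ((hP' x).1 hx) a]
  have lin : Fop D i (bracket D (pl D p i J K l) i J K) =
      ∑ B : Finset (Fin t), ((-T 1 : LaurentPolynomial ℤ) ^ B.card) •
        ∑ A ∈ J.powersetCard l, (T (nA J A : ℤ) : LaurentPolynomial ℤ) •
          Fop D i (Q (UpSet A B K)) := by
    rw [br l hl]
    simp only [Fop_eq, map_sum, map_smul]
  have rhs : (if l = J.card then 0 else bracket D (pl D p i J K (l + 1)) i J K) =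
      ∑ B : Finset (Fin t), ((-T 1 : LaurentPolynomial ℤ) ^ B.card) •
        ∑ A ∈ J.powersetCard (l + 1), (T (nA J A : ℤ) : LaurentPolynomial ℤ) •
          Q (UpSet A B K) := by
    split_ifs with h
    · rw [Finset.powersetCard_eq_empty.2 (by omega)]
      simp
    · exact br (l + 1) (by omega)
  have split : ∀ B : Finset (Fin t), ∑ A ∈ J.powersetCard l,
      (T (nA J A : ℤ) : LaurentPolynomial ℤ) • Fop D i (Q (UpSet A B K)) =
      ∑ A ∈ J.powersetCard l, (T (nA J A : ℤ) : LaurentPolynomial ℤ) •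
        ∑ x ∈ J, term J K Q (UpSet A B K) x +
      ∑ A ∈ J.powersetCard l, (T (nA J A : ℤ) : LaurentPolynomial ℤ) •
        ∑ s, (term J K Q (UpSet A B K) (K s).1 + term J K Q (UpSet A B K) (K s).2) := by
    intro B
    rw [← Finset.sum_add_distrib]
    apply Finset.sum_congr rfl
    intro A hA
    rw [FQ (Finset.mem_powersetCard.1 hA).1, smul_add]
  rw [lin, rhs, Finset.smul_sum]
  simp only [split, smul_add, Finset.sum_add_distrib (s := Finset.univ (α := Finset (Fin t)))]
  have Z : ∑ B : Finset (Fin t), ((-T 1 : LaurentPolynomial ℤ) ^ B.card) •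
      ∑ A ∈ J.powersetCard l, (T (nA J A : ℤ) : LaurentPolynomial ℤ) •
        ∑ s, (term J K Q (UpSet A B K) (K s).1 + term J K Q (UpSet A B K) (K s).2) = 0 := by
    simp only [Finset.smul_sum]
    rw [Finset.sum_comm]
    apply Finset.sum_eq_zero
    intro A hA
    rw [Finset.sum_comm]
    apply Finset.sum_eq_zero
    intro s _
    have := cancelK Q (Finset.mem_powersetCard.1 hA).1 hKlt hJK hKK hnoJ hnest s
    have h2 := congrArg (fun z => (T (nA J A : ℤ) : LaurentPolynomial ℤ) • z) this
    simp only [Finset.smul_sum, smul_zero] at h2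
    rw [← h2]
    apply Finset.sum_congr rfl
    intro B _
    rw [smul_comm]
  simp only [smul_add, Finset.sum_add_distrib] at Z ⊢
  rw [Z, add_zero]
  apply Finset.sum_congr rfl
  intro B _
  rw [sumJ Q B hKlt hJK hKK hnoJ l, smul_comm]
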